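/- For every integer n ≥ 1 the scalar curvature function Scal(φ) = −F_n(φ)/φ^{n−1} + 2(φ − n − 1) satisfies −2(n+1) < Scal(φ) < 0 for all φ > 0, and Scal(φ) → −2(n+1) as φ → 0⁺ (so the lower bound −2m, with m = n+1 the complex dimension, is sharp). -/

import Mathlib

open MeasureTheory Filter Set

/-- `Fn n φ = (2·(−1)^(n+1)·(n+1)!/φ)·(∑_{k=0}^{n+1} (−1)^k φ^k/k! − e^{−φ})`. -/
noncomputable def Fn (n : ℕ) (φ : ℝ) : ℝ :=
  2 * (-1 : ℝ) ^ (n + 1) * (Nat.factorial (n + 1)) / φ *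
    ((∑ k ∈ Finset.range (n + 2), (-1 : ℝ) ^ k * φ ^ k / (Nat.factorial k)) - Real.exp (-φ))

/-- The signed Taylor remainder `(-1)^m (∑_{k ≤ m} (-x)^k/k! - e^{-x})` of `e^{-x}`. -/
noncomputable def expNegRemainder (m : ℕ) (x : ℝ) : ℝ :=
  (-1 : ℝ) ^ m *
    ((∑ k ∈ Finset.range (m + 1), (-1 : ℝ) ^ k * x ^ k / (Nat.factorial k)) - Real.exp (-x))

theorem expNegRemainder_zero (x : ℝ) : expNegRemainder 0 x = 1 - Real.exp (-x) := by
  simp [expNegRemainder]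

theorem expNegRemainder_succ (m : ℕ) (x : ℝ) :
    expNegRemainder (m + 1) x = x ^ (m + 1) / (Nat.factorial (m + 1)) - expNegRemainder m x := by
  have h : ((-1 : ℝ) ^ m) * (-1) ^ m = 1 := by rw [← mul_pow]; simp
  unfold expNegRemainder
  rw [Finset.sum_range_succ _ (m + 1), pow_succ (-1 : ℝ) m]
  linear_combination (x ^ (m + 1) / (Nat.factorial (m + 1))) * h

theorem expNegRemainder_apply_zero (m : ℕ) : expNegRemainder m 0 = 0 := by
  induction m with
  | zero => simp [expNegRemainder_zero]
  | succ m ih => simp [expNegRemainder_succ, ih]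

theorem hasDerivAt_expNegRemainder_zero (x : ℝ) :
    HasDerivAt (expNegRemainder 0) (Real.exp (-x)) x := by
  rw [funext expNegRemainder_zero]
  simpa using ((hasDerivAt_neg x).exp).const_sub 1

theorem hasDerivAt_expNegRemainder_succ (m : ℕ) (x : ℝ) :
    HasDerivAt (expNegRemainder (m + 1)) (expNegRemainder m x) x := by
  have hpow (m : ℕ) : HasDerivAt (fun y : ℝ => y ^ (m + 1) / (Nat.factorial (m + 1)))
      (x ^ m / (Nat.factorial m)) x := by
    refine ((hasDerivAt_pow (m + 1) x).div_const _).congr_deriv ?_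
    have := Nat.factorial_ne_zero m
    rw [Nat.factorial_succ]
    push_cast
    field_simp
  induction m with
  | zero =>
    rw [funext (expNegRemainder_succ 0), expNegRemainder_zero]
    exact ((hpow 0).sub (hasDerivAt_expNegRemainder_zero x)).congr_deriv (by simp)
  | succ m ih =>
    rw [funext (expNegRemainder_succ (m + 1)), expNegRemainder_succ m]
    exact (hpow (m + 1)).sub ih

theorem expNegRemainder_pos (m : ℕ) {x : ℝ} (hx : 0 < x) : 0 < expNegRemainder m x := by
  induction m generalizing x with
  | zero => simpa [expNegRemainder_zero] using hx
  | succ m ih =>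
    have hmono : StrictMonoOn (expNegRemainder (m + 1)) (Set.Ici 0) := by
      refine strictMonoOn_of_deriv_pos (convex_Ici 0)
        (fun y _ => (hasDerivAt_expNegRemainder_succ m y).continuousAt.continuousWithinAt) ?_
      intro y hy
      rw [interior_Ici] at hy
      rw [(hasDerivAt_expNegRemainder_succ m y).deriv]
      exact ih hy
    simpa [expNegRemainder_apply_zero] using hmono (Set.mem_Ici.2 le_rfl) (Set.mem_Ici.2 hx.le) hx

theorem expNegRemainder_lt (m : ℕ) {x : ℝ} (hx : 0 < x) :
    expNegRemainder m x < x ^ (m + 1) / (Nat.factorial (m + 1)) := by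
  have := expNegRemainder_pos (m + 1) hx
  rw [expNegRemainder_succ] at this
  linarith

theorem scal_eq_expNegRemainder {n : ℕ} (hn : 1 ≤ n) {φ : ℝ} (hφ : 0 < φ) :
    -Fn n φ / φ ^ (n - 1) + 2 * (φ - (n : ℝ) - 1) =
      2 * ((n : ℝ) + 1) * ((Nat.factorial n) * expNegRemainder n φ / φ ^ n) -
        2 * ((n : ℝ) + 1) := by
  have hF : Fn n φ = 2 * (Nat.factorial (n + 1)) / φ * expNegRemainder (n + 1) φ := by
    unfold Fn expNegRemainder
    ring
  obtain ⟨k, rfl⟩ := Nat.exists_eq_add_of_le' hn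
  have hfac := Nat.factorial_ne_zero (k + 1)
  rw [hF, expNegRemainder_succ, Nat.factorial_succ (k + 1), Nat.add_sub_cancel]
  generalize Nat.factorial (k + 1) = a at hfac ⊢
  have ha : (a : ℝ) ≠ 0 := Nat.cast_ne_zero.2 hfac
  have hk : (k : ℝ) + 1 + 1 ≠ 0 := by positivity
  push_cast
  field_simp
  ring

/-- The scalar curvature `Scal(φ) = −Fn n φ/φ^{n−1} + 2(φ − n − 1)` of the Heisenberg
Kähler–Ricci soliton satisfies `−2(n+1) < Scal(φ) < 0` for all `φ > 0`, with
`Scal(φ) → −2(n+1)` as `φ → 0⁺` (so the lower bound `−2m`, `m = n+1`, is sharp). -/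
theorem scal_bounds (n : ℕ) (hn : 1 ≤ n) :
    (∀ φ : ℝ, 0 < φ →
      -2 * ((n : ℝ) + 1) < -Fn n φ / φ ^ (n - 1) + 2 * (φ - (n : ℝ) - 1) ∧
      -Fn n φ / φ ^ (n - 1) + 2 * (φ - (n : ℝ) - 1) < 0) ∧
    Tendsto (fun φ : ℝ => -Fn n φ / φ ^ (n - 1) + 2 * (φ - (n : ℝ) - 1))
      (nhdsWithin 0 (Set.Ioi 0)) (nhds (-2 * ((n : ℝ) + 1))) := by
  have hn1 : (0 : ℝ) < 2 * ((n : ℝ) + 1) := by positivity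
  have hfac : (0 : ℝ) < Nat.factorial n := by exact_mod_cast Nat.factorial_pos n
  have hpos {φ : ℝ} (hφ : 0 < φ) :
      0 < (Nat.factorial n) * expNegRemainder n φ / φ ^ n := by
    have := expNegRemainder_pos n hφ
    positivity
  refine ⟨fun φ hφ => ?_, ?_⟩
  · have hlt : (Nat.factorial n) * expNegRemainder n φ / φ ^ n < 1 := by
      obtain ⟨k, rfl⟩ := Nat.exists_eq_add_of_le' hn
      rw [div_lt_one (by positivity), mul_comm, ← lt_div_iff₀ hfac]
      have := expNegRemainder_pos k hφ
      rw [expNegRemainder_succ]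
      linarith
    rw [scal_eq_expNegRemainder hn hφ]
    constructor
    · linarith [mul_pos hn1 (hpos hφ)]
    · linarith [mul_lt_mul_of_pos_left hlt hn1]
  · have hlim : Tendsto (fun φ : ℝ => (Nat.factorial n) * expNegRemainder n φ / φ ^ n)
        (nhdsWithin 0 (Set.Ioi 0)) (nhds 0) := by
      refine squeeze_zero' (g := fun φ => φ) ?_ ?_ (tendsto_id.mono_left nhdsWithin_le_nhds)
      · filter_upwards [self_mem_nhdsWithin] with φ hφ using (hpos hφ).le
      · filter_upwards [self_mem_nhdsWithin] with φ (hφ : 0 < φ)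
        rw [div_le_iff₀ (by positivity), mul_comm, ← le_div_iff₀ hfac, ← pow_succ']
        refine (expNegRemainder_lt n hφ).le.trans ?_
        gcongr
        exact n.le_succ
    have hscal := (hlim.const_mul (2 * ((n : ℝ) + 1))).sub_const (2 * ((n : ℝ) + 1))
    rw [mul_zero, zero_sub, ← neg_mul] at hscal
    refine hscal.congr' ?_
    filter_upwards [self_mem_nhdsWithin] with φ hφ using (scal_eq_expNegRemainder hn hφ).symm
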